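/- Let φ : K[z_1,…,z_s] → R be the K-algebra homomorphism with φ(z_i) = f_i for each i. Fix a positive integer m and an integer j with 0 ≤ j ≤ h−c_0, and set K_j(z) = ⋂_{c=c_0}^{h−j} ⋂_{S ⊆ {1,…,s}, |S| = c} ⟨z_i : i ∈ S⟩^{m·μ̂_c} in K[z_1,…,z_s], and K_j = ⋂_{c=c_0}^{h−j} I_{c,F}^{(m·μ̂_c)} in R. Then K_j equals the extension ideal φ(K_j(z))R, i.e., the ideal of R generated by the image of K_j(z) under φ. -/

import Mathlib

open MvPolynomial

/-- The `N`-th symbolic power of an ideal `I`: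
`I^{(N)} = ⋂_{p ∈ Ass(R/I)} (I^N R_p ∩ R)`, where `I^N R_p ∩ R` is the preimage in `R` of
the image of `I^N` under the localization map `R → R_p`. -/
noncomputable def symbolicPower {R : Type*} [CommRing R] (I : Ideal R) (N : ℕ) : Ideal R :=
  ⨅ (p : Ideal R) (hp : p ∈ associatedPrimes R (R ⧸ I)),
    haveI : p.IsPrime := hp.isPrime
    Ideal.comap (algebraMap R (Localization.AtPrime p))
      (Ideal.map (algebraMap R (Localization.AtPrime p)) (I ^ N))

/-- The generalized star configuration ideal (uniform `a`-fold product ideal)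
`I_a(F^b) = ⟨f₁^{n₁} ⋯ f_s^{n_s} : 0 ≤ nᵢ ≤ b, ∑ nᵢ = a⟩`. -/
noncomputable def afoldIdeal {R : Type*} [CommRing R] {s : ℕ} (f : Fin s → R) (a b : ℕ) :
    Ideal R :=
  Ideal.span {g | ∃ e : Fin s → ℕ, (∀ i, e i ≤ b) ∧ (∑ i, e i) = a ∧ g = ∏ i, f i ^ e i}

/-- The star configuration ideal of codimension `c`:
`I_{c,F} = ⋂_{i₁ < ⋯ < i_c} ⟨f_{i₁}, …, f_{i_c}⟩`. -/
noncomputable def starConfigIdeal {R : Type*} [CommRing R] {s : ℕ} (f : Fin s → R) (c : ℕ) :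
    Ideal R :=
  ⨅ (T : Finset (Fin s)) (_ : T.card = c), Ideal.span (f '' (T : Set (Fin s)))

/-- `x` is a nonzerodivisor modulo the ideal `J`. -/
def IsNonzerodivisorMod {R : Type*} [CommRing R] (J : Ideal R) (x : R) : Prop :=
  ∀ g, x * g ∈ J → g ∈ J

/-- The family `(f i)_{i ∈ T}` is a weakly regular sequence modulo `I` in every order. -/
def IsPermRegularMod {R ι : Type*} [CommRing R] (f : ι → R) (I : Ideal R) (T : Finset ι) : Prop :=
  ∀ T' ⊆ T, ∀ i ∈ T, i ∉ T' → IsNonzerodivisorMod (I ⊔ Ideal.span (f '' (T' : Set ι))) (f i)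

section PermRegular

variable {R ι : Type*} [CommRing R]

theorem IsNonzerodivisorMod.pow {J : Ideal R} {x : R} (hx : IsNonzerodivisorMod J x) (k : ℕ) :
    IsNonzerodivisorMod J (x ^ k) := by
  induction k with
  | zero => intro g hg; simpa using hg
  | succ k ih => intro g hg; exact hx _ (ih _ (by rwa [← mul_assoc, ← pow_succ]))

theorem IsNonzerodivisorMod.prod {J : Ideal R} {x : ι → R} {T : Finset ι}
    (hx : ∀ i ∈ T, IsNonzerodivisorMod J (x i)) : IsNonzerodivisorMod J (∏ i ∈ T, x i) := by
  classical
  induction T using Finset.induction_on with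
  | empty => intro g hg; simpa using hg
  | insert i T hi ih =>
    intro g hg
    rw [Finset.prod_insert hi, mul_assoc] at hg
    exact ih (fun k hk => hx k (Finset.mem_insert_of_mem hk)) _
      (hx i (Finset.mem_insert_self i T) _ hg)

theorem mem_sup_span_pair_iff {J : Ideal R} {y x : R} :
    x ∈ J ⊔ Ideal.span {y} ↔ ∃ k, x - y * k ∈ J := by
  constructor
  · intro h
    obtain ⟨u, hu, v, hv, rfl⟩ := Submodule.mem_sup.mp h
    obtain ⟨k, rfl⟩ := Ideal.mem_span_singleton.mp hv
    exact ⟨k, by simpa using hu⟩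
  · rintro ⟨k, hk⟩
    have := Ideal.add_mem (J ⊔ Ideal.span {y}) (Ideal.mem_sup_left hk)
      (Ideal.mem_sup_right (Ideal.mul_mem_right k _ (Ideal.mem_span_singleton_self y)))
    simpa using this

theorem IsNonzerodivisorMod.sup_span_pow {J : Ideal R} {x y : R}
    (hy : IsNonzerodivisorMod J y) (hx : IsNonzerodivisorMod (J ⊔ Ideal.span {y}) x) (k : ℕ) :
    IsNonzerodivisorMod (J ⊔ Ideal.span {y ^ k}) x := by
  induction k with
  | zero => intro g _; simp [Ideal.span_singleton_one]
  | succ k ih =>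
    intro g hg
    obtain ⟨u, hu⟩ := mem_sup_span_pair_iff.mp hg
    obtain ⟨v, hv⟩ := mem_sup_span_pair_iff.mp
      (hx g (mem_sup_span_pair_iff.mpr ⟨y ^ k * u, by convert hu using 1; ring⟩))
    have h1 : y * (x * v - y ^ k * u) ∈ J := by
      have := J.sub_mem hu (J.mul_mem_left x hv)
      convert this using 1; ring
    obtain ⟨w, hw⟩ := mem_sup_span_pair_iff.mp (ih v (mem_sup_span_pair_iff.mpr ⟨u, hy _ h1⟩))
    refine mem_sup_span_pair_iff.mpr ⟨w, ?_⟩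
    have := J.add_mem hv (J.mul_mem_left y hw)
    convert this using 1; ring

theorem IsPermRegularMod.sup_span_pow [DecidableEq ι] {f : ι → R} {I : Ideal R} {T : Finset ι}
    {t : ι} (ht : t ∉ T) (h : IsPermRegularMod f I (insert t T)) (k : ℕ) :
    IsPermRegularMod f (I ⊔ Ideal.span {f t ^ k}) T := by
  intro T' hT' i hi hiT'
  rw [sup_right_comm]
  apply IsNonzerodivisorMod.sup_span_pow
  · exact h T' (hT'.trans (Finset.subset_insert _ _)) t (Finset.mem_insert_self _ _)
      (fun hh => ht (hT' hh))
  · have := h (insert t T') (Finset.insert_subset_insert _ hT') i (Finset.mem_insert_of_mem hi)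
      (by
        rw [Finset.mem_insert]
        rintro (rfl | h')
        exacts [ht hi, hiT' h'])
    rwa [Finset.coe_insert, Set.image_insert_eq, Ideal.span_insert, sup_comm (Ideal.span {f t}),
      ← sup_assoc] at this

theorem IsPermRegularMod.mem_of_mul_prod_pow_mem {f : ι → R} {T : Finset ι}
    (a : ι → ℕ) {g : R} {I : Ideal R} (h : IsPermRegularMod f I T)
    (hg : g * ∏ t ∈ T, f t ^ a t ∈ I ⊔ Ideal.span ((fun t => f t ^ (a t + 1)) '' (T : Set ι))) :
    g ∈ I ⊔ Ideal.span (f '' (T : Set ι)) := by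
  classical
  induction T using Finset.induction_on generalizing g I with
  | empty => simpa using hg
  | insert t T ht ih =>
    have h1 := ih (g := g * f t ^ a t) (h.sup_span_pow ht (a t + 1)) (by
      rw [Finset.prod_insert ht, ← mul_assoc, Finset.coe_insert, Set.image_insert_eq,
        Ideal.span_insert, ← sup_assoc] at hg
      exact hg)
    rw [sup_right_comm] at h1
    obtain ⟨v, hv⟩ := mem_sup_span_pair_iff.mp h1
    have h2 : f t ^ a t * (g - f t * v) ∈ I ⊔ Ideal.span (f '' (T : Set ι)) := by
      convert hv using 1; ring
    have h3 := ((h T (Finset.subset_insert _ _) t (Finset.mem_insert_self _ _) ht).pow _) _ h2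
    rw [Finset.coe_insert, Set.image_insert_eq, Ideal.span_insert, sup_comm (Ideal.span {f t}),
      ← sup_assoc]
    exact mem_sup_span_pair_iff.mpr ⟨v, h3⟩

end PermRegular

section Generic

variable {R ι : Type*} [CommRing R]

/-- Any `f i` is a nonzerodivisor modulo the ideal generated by at most `h` other members of the
family. -/
def IsWeaklyGeneric (f : ι → R) (h : ℕ) : Prop :=
  ∀ T : Finset ι, T.card ≤ h → ∀ i ∉ T, IsNonzerodivisorMod (Ideal.span (f '' (T : Set ι))) (f i)

theorem isWeaklyGeneric_of_isRegular {f : ι → R} {h : ℕ}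
    (hf : ∀ l : List ι, l.Nodup → l.length ≤ h + 1 →
      RingTheory.Sequence.IsRegular R (l.map f)) : IsWeaklyGeneric f h := by
  intro T hT i hi g hg
  have hreg := (hf (T.toList ++ [i])
    (by
      rw [List.nodup_append]
      refine ⟨T.nodup_toList, List.nodup_singleton i, ?_⟩
      intro x hx y hy
      rw [List.mem_singleton] at hy
      rintro rfl
      exact hi (hy ▸ Finset.mem_toList.mp hx))
    (by simpa using hT)).regular_mod_prev T.card (by simp)
  have htake : (List.map f (T.toList ++ [i])).take T.card = T.toList.map f := by
    rw [List.map_append, List.take_left' (by simp)]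
  have hget : (List.map f (T.toList ++ [i]))[T.card]'(by simp) = f i := by
    simp [List.getElem_append_right]
  have hid : (Ideal.ofList (T.toList.map f) • (⊤ : Submodule R R)) =
      Ideal.span (f '' (T : Set ι)) := by
    rw [smul_eq_mul, Ideal.mul_top, Ideal.ofList]
    congr 1
    ext x
    simp
  rw [htake, hget, hid] at hreg
  rw [isSMulRegular_iff_right_eq_zero_of_smul] at hreg
  have := hreg (Submodule.Quotient.mk g)
    (by rw [← Submodule.Quotient.mk_smul, Submodule.Quotient.mk_eq_zero]; exact hg)
  rwa [Submodule.Quotient.mk_eq_zero] at this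

theorem IsWeaklyGeneric.isPermRegularMod {f : ι → R} {h : ℕ} (hf : IsWeaklyGeneric f h)
    {T : Finset ι} (hT : T.card ≤ h) : IsPermRegularMod f ⊥ T := by
  intro T' hT' i _ hi
  rw [bot_sup_eq]
  exact hf T' ((Finset.card_le_card hT').trans hT) i hi

variable [Fintype ι]

theorem IsWeaklyGeneric.mem_of_mul_prod_pow_mem {f : ι → R} {h : ℕ} (hf : IsWeaklyGeneric f h)
    {T : Finset ι} (hT : T.card ≤ h) (a : ι → ℕ) {g : R}
    (hg : g * ∏ i, f i ^ a i ∈ Ideal.span ((fun t => f t ^ (a t + 1)) '' (T : Set ι))) :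
    g ∈ Ideal.span (f '' (T : Set ι)) := by
  classical
  rw [← Finset.prod_mul_prod_compl T, mul_comm (∏ t ∈ T, _), ← mul_assoc] at hg
  have h1 := (hf.isPermRegularMod hT).mem_of_mul_prod_pow_mem a (by rwa [bot_sup_eq])
  rw [bot_sup_eq, mul_comm] at h1
  exact IsNonzerodivisorMod.prod (fun i hi => (hf T hT i (Finset.mem_compl.mp hi)).pow _) _ h1

theorem prod_pow_mem_span_pow_succ (f : ι → R) {T : Finset ι} {a e : ι → ℕ}
    (h : ∃ t ∈ T, a t < e t) :
    ∏ i, f i ^ e i ∈ Ideal.span ((fun t => f t ^ (a t + 1)) '' (T : Set ι)) := by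
  obtain ⟨t, ht, hlt⟩ := h
  exact Ideal.mem_of_dvd _ ((pow_dvd_pow _ hlt).trans (Finset.dvd_prod_of_mem _ (Finset.mem_univ t)))
    (Ideal.subset_span ⟨t, ht, rfl⟩)

theorem IsWeaklyGeneric.coeff_mem {f : ι → R} {h : ℕ} (hf : IsWeaklyGeneric f h)
    {T : Finset ι} (hT : T.card ≤ h) (l : (ι → ℕ) →₀ R) (a : ι → ℕ)
    (hl : ∀ e ∈ l.support, e ≠ a → ∃ t ∈ T, a t < e t)
    (hmem : ∑ e ∈ l.support, l e * ∏ i, f i ^ e i ∈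
      Ideal.span ((fun t => f t ^ (a t + 1)) '' (T : Set ι))) :
    l a ∈ Ideal.span (f '' (T : Set ι)) := by
  classical
  by_cases ha : a ∈ l.support
  · apply hf.mem_of_mul_prod_pow_mem hT a
    rw [← Finset.add_sum_erase _ _ ha] at hmem
    refine (Ideal.add_mem_iff_left _ (Ideal.sum_mem _ fun e he => ?_)).mp hmem
    rw [Finset.mem_erase] at he
    exact Ideal.mul_mem_left _ _ (prod_pow_mem_span_pow_succ f (hl e he.2 he.1))
  · rw [Finsupp.notMem_support_iff.mp ha]
    exact Ideal.zero_mem _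

theorem prod_pow_add_single [DecidableEq ι] (f : ι → R) (e : ι → ℕ) (t : ι) :
    ∏ i, f i ^ (e + Pi.single t 1 : ι → ℕ) i = (∏ i, f i ^ e i) * f t := by
  simp only [Pi.add_apply, pow_add, Finset.prod_mul_distrib]
  congr 1
  rw [Finset.prod_eq_single t]
  · simp
  · intro b _ hb; simp [Pi.single_eq_of_ne hb]
  · simp

/-- The ideal generated by the monomials in the family `f` with exponent vectors in `E`. -/
def monomialIdeal (f : ι → R) (E : Set (ι → ℕ)) : Ideal R :=
  Ideal.span ((fun e : ι → ℕ => ∏ i, f i ^ e i) '' E)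

theorem span_image_pow_le (f : ι → R) (T : Finset ι) (k : ℕ) :
    Ideal.span (f '' (T : Set ι)) ^ k ≤
      monomialIdeal f {e | (∀ i ∉ T, e i = 0) ∧ ∑ i ∈ T, e i = k} := by
  classical
  induction k with
  | zero =>
    intro x _
    have h1 : (1 : R) ∈ monomialIdeal f {e | (∀ i ∉ T, e i = 0) ∧ ∑ i ∈ T, e i = 0} :=
      Ideal.subset_span ⟨0, by simp, by simp⟩
    rw [(Ideal.eq_top_iff_one _).mpr h1]
    trivial
  | succ k ih =>
    rw [pow_succ]
    refine (Ideal.mul_mono_left ih).trans ?_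
    rw [monomialIdeal, Ideal.span_mul_span, Ideal.span_le]
    rintro _ ⟨_, ⟨e, ⟨he0, hek⟩, rfl⟩, _, ⟨t, ht, rfl⟩, rfl⟩
    refine Ideal.subset_span ⟨e + Pi.single t 1, ⟨?_, ?_⟩, prod_pow_add_single f e t⟩
    · intro i hi
      have : i ≠ t := fun hh => hi (hh ▸ ht)
      simp [he0 i hi, this]
    · simp only [Pi.add_apply, Finset.sum_add_distrib, hek]
      simpa using ht

theorem span_image_pow_le_span_pow_succ (f : ι → R) {T : Finset ι} {k : ℕ} {a : ι → ℕ}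
    (ha : ∑ i ∈ T, a i < k) :
    Ideal.span (f '' (T : Set ι)) ^ k ≤
      Ideal.span ((fun t => f t ^ (a t + 1)) '' (T : Set ι)) := by
  refine (span_image_pow_le f T k).trans ?_
  rw [monomialIdeal, Ideal.span_le]
  rintro _ ⟨e, ⟨_, hek⟩, rfl⟩
  exact prod_pow_mem_span_pow_succ f (Finset.exists_lt_of_sum_lt (hek ▸ ha))

theorem prod_pow_mem_span_image_pow (f : ι → R)
    {S : Finset ι} {N : ℕ} {e : ι → ℕ} (h : N ≤ ∑ i ∈ S, e i) :
    ∏ i, f i ^ e i ∈ Ideal.span (f '' (S : Set ι)) ^ N := by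
  refine Ideal.pow_le_pow_right h ?_
  rw [← Finset.prod_pow_eq_pow_sum]
  refine Ideal.mem_of_dvd _ (Finset.prod_dvd_prod_of_subset _ _ _ (Finset.subset_univ S)) ?_
  exact Ideal.prod_mem_prod fun i hi =>
    Ideal.pow_mem_pow (Ideal.subset_span (Set.mem_image_of_mem f hi)) _

theorem exists_finsupp_of_mem_monomialIdeal {f : ι → R} {E : Set (ι → ℕ)} {x : R}
    (hx : x ∈ monomialIdeal f E) :
    ∃ l : (ι → ℕ) →₀ R, (l.support : Set (ι → ℕ)) ⊆ E ∧
      ∑ e ∈ l.support, l e * ∏ i, f i ^ e i = x := by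
  obtain ⟨l, hl, hlx⟩ := (Finsupp.mem_span_image_iff_linearCombination R).mp hx
  exact ⟨l, hl, by simpa [Finsupp.linearCombination_apply, Finsupp.sum] using hlx⟩

end Generic

section SymbolicPower

variable {R : Type*} [CommRing R]

theorem mem_associatedPrimes_quotient_iff [IsNoetherianRing R] {J p : Ideal R} :
    p ∈ associatedPrimes R (R ⧸ J) ↔ p.IsPrime ∧ ∃ g, ∀ y, y ∈ p ↔ y * g ∈ J := by
  rw [AssociatedPrimes.mem_iff, isAssociatedPrime_iff]
  refine and_congr_right fun _ => ⟨?_, ?_⟩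
  · rintro ⟨x, rfl⟩
    obtain ⟨g, rfl⟩ := Ideal.Quotient.mk_surjective x
    refine ⟨g, fun y => ?_⟩
    rw [Submodule.mem_colon_singleton, Submodule.mem_bot, ← Ideal.Quotient.eq_zero_iff_mem,
      map_mul, Algebra.smul_def, Ideal.Quotient.algebraMap_eq]
  · rintro ⟨g, hg⟩
    refine ⟨Ideal.Quotient.mk J g, Ideal.ext fun y => ?_⟩
    rw [hg, Submodule.mem_colon_singleton, Submodule.mem_bot, ← Ideal.Quotient.eq_zero_iff_mem,
      map_mul, Algebra.smul_def, Ideal.Quotient.algebraMap_eq]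

theorem exists_mem_associatedPrimes_quotient [IsNoetherianRing R] {J : Ideal R} {g : R}
    (hg : g ∉ J) : ∃ p ∈ associatedPrimes R (R ⧸ J), ∀ y, y * g ∈ J → y ∈ p := by
  obtain ⟨p, hp, hle⟩ := exists_le_isAssociatedPrime_of_isNoetherianRing R
    (Ideal.Quotient.mk J g) (by rwa [Ne, Ideal.Quotient.eq_zero_iff_mem])
  refine ⟨p, hp, fun y hy => hle ?_⟩
  rwa [Submodule.mem_colon_singleton, Submodule.mem_bot, Algebra.smul_def,
    Ideal.Quotient.algebraMap_eq, ← map_mul, Ideal.Quotient.eq_zero_iff_mem]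

theorem mem_symbolicPower_iff {I : Ideal R} {N : ℕ} {x : R} :
    x ∈ symbolicPower I N ↔
      ∀ p ∈ associatedPrimes R (R ⧸ I), ∃ u ∉ p, u * x ∈ I ^ N := by
  rw [symbolicPower, Submodule.mem_iInf]
  refine forall_congr' fun p => ?_
  rw [Submodule.mem_iInf]
  refine forall_congr' fun hp => ?_
  have : p.IsPrime := hp.isPrime
  rw [Ideal.mem_comap, IsLocalization.algebraMap_mem_map_algebraMap_iff p.primeCompl]
  rfl

theorem IsWeaklyGeneric.mem_span_image_pow {ι : Type*} [Fintype ι] [IsNoetherianRing R]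
    {f : ι → R} {h : ℕ} (hf : IsWeaklyGeneric f h) {T : Finset ι} (hT : T.card ≤ h) {N : ℕ} {x : R}
    (hx : ∀ p ∈ associatedPrimes R (R ⧸ Ideal.span (f '' (T : Set ι))),
      ∃ u ∉ p, u * x ∈ Ideal.span (f '' (T : Set ι)) ^ N) :
    x ∈ Ideal.span (f '' (T : Set ι)) ^ N := by
  suffices H : ∀ k ≤ N, x ∈ Ideal.span (f '' (T : Set ι)) ^ k from H N le_rfl
  intro k
  induction k with
  | zero => simp
  | succ k ih =>
    intro hk
    obtain ⟨l, hl, rfl⟩ := exists_finsupp_of_mem_monomialIdeal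
      (span_image_pow_le f T k (ih (Nat.le_of_succ_le hk)))
    have hcoeff : ∀ a, l a ∈ Ideal.span (f '' (T : Set ι)) := by
      intro a
      by_contra ha
      obtain ⟨p, hp, hle⟩ := exists_mem_associatedPrimes_quotient ha
      obtain ⟨u, hu, hux⟩ := hx p hp
      refine hu (hle u ?_)
      have hla : a ∈ l.support := by
        rw [Finsupp.mem_support_iff]
        intro h0
        exact ha (h0 ▸ Ideal.zero_mem _)
      obtain ⟨ha0, hak⟩ := hl hla
      have hsub : (u • l).support ⊆ l.support := Finsupp.support_smul
      refine hf.coeff_mem hT (u • l) a ?_ ?_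
      · intro e he hea
        obtain ⟨he0, hek⟩ := hl (hsub he)
        by_contra! hcon
        refine hea (funext fun i => ?_)
        by_cases hi : i ∈ T
        · exact (Finset.sum_eq_sum_iff_of_le hcon).mp (hek.trans hak.symm) i hi
        · rw [he0 i hi, ha0 i hi]
      · rw [Finset.sum_subset hsub]
        · rw [Finset.mul_sum] at hux
          have := span_image_pow_le_span_pow_succ f (hak.trans_lt (Nat.lt_succ_self k))
            (Ideal.pow_le_pow_right hk hux)
          simpa [mul_assoc] using this
        · intro e _ he
          rw [Finsupp.notMem_support_iff.mp he, zero_mul]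
    refine Ideal.sum_mem _ fun e he => ?_
    obtain ⟨_, hek⟩ := hl he
    rw [pow_succ']
    exact Ideal.mul_mem_mul (hcoeff e) (prod_pow_mem_span_image_pow f hek.ge)

theorem mem_starConfigIdeal_iff {s : ℕ} {f : Fin s → R} {c : ℕ} {x : R} :
    x ∈ starConfigIdeal f c ↔
      ∀ T : Finset (Fin s), T.card = c → x ∈ Ideal.span (f '' (T : Set (Fin s))) := by
  simp [starConfigIdeal, Submodule.mem_iInf]

theorem mul_prod_compl_mem_starConfigIdeal {s : ℕ} {f : Fin s → R} {S : Finset (Fin s)} {y : R}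
    (hy : y ∈ Ideal.span (f '' (S : Set (Fin s)))) :
    y * ∏ i ∈ Sᶜ, f i ∈ starConfigIdeal f S.card := by
  rw [mem_starConfigIdeal_iff]
  intro T hT
  by_cases hTS : T ⊆ S
  · rw [Finset.eq_of_subset_of_card_le hTS hT.ge]
    exact Ideal.mul_mem_right _ _ hy
  · obtain ⟨i, hiT, hiS⟩ := Finset.not_subset.mp hTS
    exact Ideal.mul_mem_left _ _ (Ideal.mem_of_dvd _
      (Finset.dvd_prod_of_mem f (Finset.mem_compl.mpr hiS)) (Ideal.subset_span ⟨i, hiT, rfl⟩))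

theorem span_image_pow_mul_prod_compl_mem {s : ℕ} {f : Fin s → R} {S : Finset (Fin s)} {N : ℕ}
    {x : R} (hx : x ∈ Ideal.span (f '' (S : Set (Fin s))) ^ N) :
    (∏ i ∈ Sᶜ, f i) ^ N * x ∈ starConfigIdeal f S.card ^ N := by
  have h1 : Ideal.span {∏ i ∈ Sᶜ, f i} * Ideal.span (f '' (S : Set (Fin s))) ≤
      starConfigIdeal f S.card := by
    rw [Ideal.span_singleton_mul_le_iff]
    intro z hz
    rw [mul_comm]
    exact mul_prod_compl_mem_starConfigIdeal hz
  have h2 := Ideal.pow_right_mono h1 N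
  rw [mul_pow] at h2
  exact h2 (Ideal.mul_mem_mul (Ideal.pow_mem_pow (Ideal.mem_span_singleton_self _) N) hx)

/-- The symbolic powers of the star configuration ideals of a generic family are intersections
of ordinary powers of complete intersections. -/
theorem mem_symbolicPower_starConfigIdeal_iff [IsNoetherianRing R] {s : ℕ} {f : Fin s → R} {h : ℕ}
    (hf : IsWeaklyGeneric f h) {c : ℕ} (hc : c ≤ h) {N : ℕ} {x : R} :
    x ∈ symbolicPower (starConfigIdeal f c) N ↔
      ∀ S : Finset (Fin s), S.card = c → x ∈ Ideal.span (f '' (S : Set (Fin s))) ^ N := by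
  rw [mem_symbolicPower_iff]
  constructor
  · rintro hx S rfl
    apply hf.mem_span_image_pow hc
    intro p hp
    obtain ⟨hprime, g, hg⟩ := mem_associatedPrimes_quotient_iff.mp hp
    have hstar : starConfigIdeal f S.card ≤ Ideal.span (f '' (S : Set (Fin s))) :=
      fun z hz => mem_starConfigIdeal_iff.mp hz S rfl
    have hpI : p ∈ associatedPrimes R (R ⧸ starConfigIdeal f S.card) := by
      refine mem_associatedPrimes_quotient_iff.mpr ⟨hprime, g * ∏ i ∈ Sᶜ, f i, fun y => ?_⟩
      rw [hg, ← mul_assoc]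
      refine ⟨mul_prod_compl_mem_starConfigIdeal, fun hy => ?_⟩
      refine IsNonzerodivisorMod.prod (x := f) (T := Sᶜ)
        (fun i hi => hf S hc i (Finset.mem_compl.mp hi)) _ ?_
      rw [mul_comm]
      exact hstar hy
    obtain ⟨u, hu, hux⟩ := hx p hpI
    exact ⟨u, hu, Ideal.pow_right_mono hstar N hux⟩
  · intro hx p hp
    obtain ⟨hprime, g, hg⟩ := mem_associatedPrimes_quotient_iff.mp hp
    have hgI : g ∉ starConfigIdeal f c := by
      intro hgI
      exact hprime.ne_top ((Ideal.eq_top_iff_one p).mpr ((hg 1).mpr (by rwa [one_mul])))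
    have key : ∃ S : Finset (Fin s), S.card = c ∧
        ∀ y, y * g ∈ Ideal.span (f '' (S : Set (Fin s))) → y ∈ p := by
      by_contra! hcon
      choose! y hy hyp using hcon
      have hprod : ∏ S ∈ Finset.univ.filter (fun S : Finset (Fin s) => S.card = c), y S ∈ p := by
        rw [hg, mem_starConfigIdeal_iff]
        intro T hT
        refine Ideal.mem_of_dvd _ (mul_dvd_mul_right (Finset.dvd_prod_of_mem y ?_) g) (hy T hT)
        simpa using hT
      obtain ⟨S, hS, hyS⟩ := (hprime.prod_mem_iff).mp hprod
      exact hyp S (by simpa using hS) hyS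
    obtain ⟨S, rfl, hS⟩ := key
    refine ⟨(∏ i ∈ Sᶜ, f i) ^ N, ?_, span_image_pow_mul_prod_compl_mem (hx S rfl)⟩
    intro hmem
    obtain ⟨i, hi, hip⟩ := hprime.prod_mem_iff.mp (hprime.mem_of_pow_mem N hmem)
    have hgS : g ∈ Ideal.span (f '' (S : Set (Fin s))) :=
      hf S hc i (Finset.mem_compl.mp hi) g
        (mem_starConfigIdeal_iff.mp ((hg _).mp hip) S rfl)
    exact hprime.ne_top ((Ideal.eq_top_iff_one p).mpr (hS 1 (by rwa [one_mul])))

end SymbolicPower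

section LowestEntries

variable {s : ℕ}

/-- `T` consists of the indices of the smallest entries of `e`, ties being broken by the index. -/
def IsLowest (e : Fin s → ℕ) (T : Finset (Fin s)) : Prop :=
  ∀ i ∈ T, ∀ j ∉ T, e i + (if j < i then 1 else 0) ≤ e j

/-- The entries of `e`, perturbed by their index so as to become pairwise distinct. -/
def indexWeight (e : Fin s → ℕ) (i : Fin s) : ℕ := s * e i + i

theorem indexWeight_lt_iff {e : Fin s → ℕ} {i j : Fin s} (hij : i ≠ j) :
    indexWeight e i < indexWeight e j ↔ e i + (if j < i then 1 else 0) ≤ e j := by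
  have hij' : (i : ℕ) ≠ j := fun h => hij (Fin.ext h)
  have hi := i.isLt
  have hj := j.isLt
  unfold indexWeight
  simp only [Fin.lt_def]
  rcases lt_trichotomy (e i) (e j) with h | h | h
  · have h1 : s * (e i + 1) ≤ s * e j := Nat.mul_le_mul_left s h
    rw [mul_add] at h1
    split_ifs <;> constructor <;> intros <;> omega
  · rw [h]
    split_ifs <;> constructor <;> intros <;> omega
  · have h1 : s * (e j + 1) ≤ s * e i := Nat.mul_le_mul_left s h
    rw [mul_add] at h1
    split_ifs <;> constructor <;> intros <;> omega

theorem isLowest_iff {e : Fin s → ℕ} {T : Finset (Fin s)} :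
    IsLowest e T ↔ ∀ i ∈ T, ∀ j ∉ T, indexWeight e i < indexWeight e j := by
  refine forall₂_congr fun i hi => forall₂_congr fun j hj => ?_
  rw [indexWeight_lt_iff]
  rintro rfl
  exact hj hi

theorem exists_subset_card_eq_sum_le {ι : Type*} [DecidableEq ι] {w : ι → ℕ} {T S : Finset ι}
    (h : ∀ i ∈ T, ∀ j ∉ T, w i ≤ w j) (hST : S.card ≤ T.card) :
    ∃ S' ⊆ T, S'.card = S.card ∧ ∑ i ∈ S', w i ≤ ∑ i ∈ S, w i := by
  induction hn : (S \ T).card generalizing S with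
  | zero =>
    exact ⟨S, Finset.sdiff_eq_empty_iff_subset.mp (Finset.card_eq_zero.mp hn), rfl, le_rfl⟩
  | succ n ih =>
    obtain ⟨j, hj⟩ := Finset.card_pos.mp (by omega : 0 < (S \ T).card)
    have hTS : 0 < (T \ S).card := by
      have h1 := Finset.card_sdiff_add_card_inter S T
      have h2 := Finset.card_sdiff_add_card_inter T S
      rw [Finset.inter_comm] at h2
      omega
    obtain ⟨i, hi⟩ := Finset.card_pos.mp hTS
    rw [Finset.mem_sdiff] at hi hj
    have hi' : i ∉ S.erase j := fun hh => hi.2 (Finset.mem_of_mem_erase hh)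
    have hcard : (insert i (S.erase j)).card = S.card := by
      rw [Finset.card_insert_of_notMem hi', Finset.card_erase_add_one hj.1]
    have hsd : insert i (S.erase j) \ T = (S \ T).erase j := by
      rw [Finset.insert_sdiff_of_mem _ hi.1, Finset.erase_sdiff_comm]
    obtain ⟨S', hS'T, hS'c, hS'⟩ := ih (S := insert i (S.erase j)) (by omega)
      (by rw [hsd, Finset.card_erase_of_mem (Finset.mem_sdiff.mpr hj), hn]; rfl)
    refine ⟨S', hS'T, hS'c.trans hcard, hS'.trans ?_⟩
    rw [Finset.sum_insert hi', ← Finset.add_sum_erase S w hj.1]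
    exact Nat.add_le_add_right (h i hi.1 j hj.2) _

theorem sum_lt_sum_of_forall_lt {ι : Type*} [DecidableEq ι] {w : ι → ℕ} {T S : Finset ι}
    (h : ∀ i ∈ T, ∀ j ∉ T, w i < w j) (hST : S.card = T.card) (hne : S ≠ T) :
    ∑ i ∈ T, w i < ∑ i ∈ S, w i := by
  have hS : ¬ S ⊆ T := fun hsub => hne (Finset.eq_of_subset_of_card_le hsub hST.ge)
  obtain ⟨j, hjS, hjT⟩ := Finset.not_subset.mp hS
  have hT : ¬ T ⊆ S := fun hsub => hne (Finset.eq_of_subset_of_card_le hsub hST.le).symm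
  obtain ⟨i, hiT, hiS⟩ := Finset.not_subset.mp hT
  have hi' : i ∉ S.erase j := fun hh => hiS (Finset.mem_of_mem_erase hh)
  have hcard : (insert i (S.erase j)).card = S.card := by
    rw [Finset.card_insert_of_notMem hi', Finset.card_erase_add_one hjS]
  obtain ⟨S', hS'T, hS'c, hS'⟩ := exists_subset_card_eq_sum_le (S := insert i (S.erase j))
    (fun i hi j hj => (h i hi j hj).le) (by omega)
  rw [Finset.eq_of_subset_of_card_le hS'T (by omega), Finset.sum_insert hi'] at hS'
  rw [← Finset.add_sum_erase S w hjS]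
  have := h i hiT j hjT
  omega

theorem exists_isLowest (e : Fin s → ℕ) {c : ℕ} (hc : c ≤ s) :
    ∃ T : Finset (Fin s), T.card = c ∧ IsLowest e T := by
  obtain ⟨T, hT, hmin⟩ := Finset.exists_min_image
    ((Finset.univ : Finset (Fin s)).powersetCard c) (fun T => ∑ i ∈ T, indexWeight e i)
    (Finset.powersetCard_nonempty.mpr (by simpa using hc))
  rw [Finset.mem_powersetCard] at hT
  refine ⟨T, hT.2, fun i hi j hj => ?_⟩
  have hij : i ≠ j := fun h => hj (h ▸ hi)
  by_contra hlt
  rw [← indexWeight_lt_iff hij, not_lt] at hlt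
  have hne : indexWeight e j ≠ indexWeight e i := by
    intro heq
    have hm := congrArg (· % s) heq
    simp only [indexWeight, Nat.mul_add_mod_self_left, Nat.mod_eq_of_lt i.isLt,
      Nat.mod_eq_of_lt j.isLt] at hm
    exact hij (Fin.ext hm.symm)
  have hj' : j ∉ T.erase i := fun hh => hj (Finset.mem_of_mem_erase hh)
  have := hmin (insert j (T.erase i)) (Finset.mem_powersetCard.mpr
    ⟨Finset.subset_univ _, by
      rw [Finset.card_insert_of_notMem hj', Finset.card_erase_add_one hi, hT.2]⟩)
  rw [Finset.sum_insert hj', ← Finset.add_sum_erase T _ hi] at this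
  omega

theorem IsLowest.sum_indexWeight_lt {e : Fin s → ℕ} {T S : Finset (Fin s)} (h : IsLowest e T)
    (hST : S.card = T.card) (hne : S ≠ T) :
    ∑ i ∈ T, indexWeight e i < ∑ i ∈ S, indexWeight e i :=
  sum_lt_sum_of_forall_lt (isLowest_iff.mp h) hST hne

theorem IsLowest.exists_subset {e : Fin s → ℕ} {T S : Finset (Fin s)} (h : IsLowest e T)
    (hST : S.card ≤ T.card) : ∃ S' ⊆ T, S'.card = S.card ∧ ∑ i ∈ S', e i ≤ ∑ i ∈ S, e i :=
  exists_subset_card_eq_sum_le (fun i hi j hj => (Nat.le_add_right _ _).trans (h i hi j hj)) hST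

/-- The smallest vector which agrees with `e` on `T` and has `T` as set of lowest indices. -/
def lowestHull (T : Finset (Fin s)) (e : Fin s → ℕ) (j : Fin s) : ℕ :=
  if j ∈ T then e j else T.sup fun i => e i + if j < i then 1 else 0

theorem lowestHull_of_mem {T : Finset (Fin s)} (e : Fin s → ℕ) {j : Fin s} (hj : j ∈ T) :
    lowestHull T e j = e j := if_pos hj

theorem lowestHull_congr {T : Finset (Fin s)} {e e' : Fin s → ℕ} (h : ∀ i ∈ T, e i = e' i) :
    lowestHull T e = lowestHull T e' := by
  funext j
  unfold lowestHull
  split_ifs with hj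
  · exact h j hj
  · exact Finset.sup_congr rfl fun i hi => by rw [h i hi]

theorem isLowest_lowestHull (T : Finset (Fin s)) (e : Fin s → ℕ) :
    IsLowest (lowestHull T e) T := by
  intro i hi j hj
  rw [lowestHull_of_mem e hi, lowestHull, if_neg hj]
  exact Finset.le_sup (f := fun i => e i + if j < i then 1 else 0) hi

theorem IsLowest.lowestHull_le {T : Finset (Fin s)} {e : Fin s → ℕ} (h : IsLowest e T) :
    lowestHull T e ≤ e := by
  intro j
  unfold lowestHull
  split_ifs with hj
  · exact le_rfl
  · exact Finset.sup_le fun i hi => h i hi j hj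

end LowestEntries

section Intersection

variable {R : Type*} [CommRing R] {s : ℕ}

theorem sum_indexWeight (e : Fin s → ℕ) (S : Finset (Fin s)) :
    ∑ i ∈ S, indexWeight e i = s * ∑ i ∈ S, e i + ∑ i ∈ S, (i : ℕ) := by
  simp only [indexWeight, Finset.sum_add_distrib, Finset.mul_sum]

theorem sum_indexWeight_le {e e' : Fin s → ℕ} {S : Finset (Fin s)} (h : ∀ i ∈ S, e i ≤ e' i) :
    ∑ i ∈ S, indexWeight e i ≤ ∑ i ∈ S, indexWeight e' i := by
  rw [sum_indexWeight, sum_indexWeight]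
  exact Nat.add_le_add_right (Nat.mul_le_mul_left s (Finset.sum_le_sum h)) _

/-- Exponent vectors in `D` whose sums over `c`-element sets are all at least `N`, or whose
perturbed sums over `c`-element sets are all at least `r`. -/
def filtrationLayer (D : Set (Fin s → ℕ)) (c N r : ℕ) : Set (Fin s → ℕ) :=
  {e | e ∈ D ∧ ((∀ S : Finset (Fin s), S.card = c → N ≤ ∑ i ∈ S, e i) ∨
    ∀ S : Finset (Fin s), S.card = c → r ≤ ∑ i ∈ S, indexWeight e i)}

/-- The exponent vectors generating the `r`-th filtration layer modulo the next one, with lowest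
index set `T`. -/
structure IsLayerGenerator (D : Set (Fin s → ℕ)) (c N r : ℕ) (a : Fin s → ℕ)
    (T : Finset (Fin s)) : Prop where
  mem : a ∈ D
  card_eq : T.card = c
  isLowest : IsLowest a T
  sum_weight : ∑ i ∈ T, indexWeight a i = r
  sum_lt : ∑ i ∈ T, a i < N
  hull_eq : lowestHull T a = a

variable {D : Set (Fin s → ℕ)} {c N r : ℕ}

theorem exists_isLayerGenerator_le (hcs : c ≤ s)
    (hD : ∀ a e T, T.card = c → IsLowest a T → (∀ i ∈ T, a i = e i) → e ∈ D → a ∈ D)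
    {e : Fin s → ℕ} (he : e ∈ filtrationLayer D c N r) (he' : e ∉ filtrationLayer D c N (r + 1)) :
    ∃ a T, IsLayerGenerator D c N r a T ∧ a ≤ e := by
  obtain ⟨T, hTc, hT⟩ := exists_isLowest e hcs
  have hcongr : ∀ i ∈ T, lowestHull T e i = e i := fun i hi => lowestHull_of_mem e hi
  have hnot : ¬ ((∀ S : Finset (Fin s), S.card = c → N ≤ ∑ i ∈ S, e i) ∨
      ∀ S : Finset (Fin s), S.card = c → r + 1 ≤ ∑ i ∈ S, indexWeight e i) :=
    fun hh => he' ⟨he.1, hh⟩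
  push Not at hnot
  obtain ⟨⟨S, hSc, hS⟩, S₂, hS₂c, hS₂⟩ := hnot
  have hsum : ∑ i ∈ T, indexWeight e i = r := by
    have h1 : r ≤ ∑ i ∈ T, indexWeight e i := by
      rcases he.2 with h | h
      · exact absurd (h S hSc) (not_le.mpr hS)
      · exact h T hTc
    have h2 : ∑ i ∈ T, indexWeight e i ≤ ∑ i ∈ S₂, indexWeight e i := by
      by_cases hne : S₂ = T
      · rw [hne]
      · exact (hT.sum_indexWeight_lt (hS₂c.trans hTc.symm) hne).le
    omega
  refine ⟨lowestHull T e, T, ⟨?_, hTc, isLowest_lowestHull T e, ?_, ?_, lowestHull_congr hcongr⟩,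
    hT.lowestHull_le⟩
  · exact hD _ e T hTc (isLowest_lowestHull T e) hcongr he.1
  · rw [← hsum]
    exact Finset.sum_congr rfl fun i hi => by rw [indexWeight, indexWeight, hcongr i hi]
  · rw [Finset.sum_congr rfl hcongr]
    obtain ⟨S', hS'T, hS'c, hS'⟩ := hT.exists_subset (hSc.trans hTc.symm).le
    rw [Finset.eq_of_subset_of_card_le hS'T (by omega)] at hS'
    exact hS'.trans_lt hS

theorem IsLayerGenerator.add_single_mem (hDup : IsUpperSet D) {a : Fin s → ℕ}
    {T : Finset (Fin s)} (h : IsLayerGenerator D c N r a T) {t : Fin s} (ht : t ∈ T) :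
    (a + Pi.single t 1 : Fin s → ℕ) ∈ filtrationLayer D c N (r + 1) := by
  have hle : a ≤ a + Pi.single t 1 := le_self_add
  refine ⟨hDup hle h.mem, Or.inr fun S hS => ?_⟩
  by_cases hST : S = T
  · subst hST
    have h1 : ∑ i ∈ S, (a + Pi.single t 1 : Fin s → ℕ) i = ∑ i ∈ S, a i + 1 := by
      simp only [Pi.add_apply, Finset.sum_add_distrib]
      simpa using ht
    have h2 := h.sum_weight
    rw [sum_indexWeight] at h2 ⊢
    rw [h1, mul_add]
    have := t.pos
    omega
  · have h1 := h.isLowest.sum_indexWeight_lt (hS.trans h.card_eq.symm) hST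
    rw [h.sum_weight] at h1
    exact h1.trans_le (sum_indexWeight_le fun i _ => hle i)

theorem IsLayerGenerator.exists_lt_of_mem {a : Fin s → ℕ}
    {T : Finset (Fin s)} (h : IsLayerGenerator D c N r a T) {u : Fin s → ℕ}
    (hu : u ∈ filtrationLayer D c N (r + 1)) : ∃ t ∈ T, a t < u t := by
  by_contra! hcon
  rcases hu.2 with h1 | h1
  · exact absurd ((h1 T h.card_eq).trans (Finset.sum_le_sum hcon)) (not_le.mpr h.sum_lt)
  · have h2 := (h1 T h.card_eq).trans (sum_indexWeight_le hcon)
    rw [h.sum_weight] at h2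
    omega

theorem IsLayerGenerator.exists_lt_of_ne {a a' : Fin s → ℕ} {T T' : Finset (Fin s)}
    (h : IsLayerGenerator D c N r a T) (h' : IsLayerGenerator D c N r a' T') (hne : a' ≠ a) :
    ∃ t ∈ T, a t < a' t := by
  by_contra! hcon
  have h1 := sum_indexWeight_le hcon
  have hTT : T = T' := by
    by_contra hTT
    have h2 := h'.isLowest.sum_indexWeight_lt (h.card_eq.trans h'.card_eq.symm) hTT
    rw [h'.sum_weight] at h2
    rw [h.sum_weight] at h1
    omega
  subst hTT
  have h3 := h.sum_weight.trans h'.sum_weight.symm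
  rw [sum_indexWeight, sum_indexWeight] at h3
  have heq : ∀ i ∈ T, a' i = a i := by
    intro i hi
    refine (Finset.sum_eq_sum_iff_of_le hcon).mp ?_ i hi
    exact (Nat.eq_of_mul_eq_mul_left i.pos (Nat.add_right_cancel h3)).symm
  rw [← h.hull_eq, ← h'.hull_eq] at hne
  exact hne (lowestHull_congr heq)

theorem monomialIdeal_mono {f : Fin s → R} {E E' : Set (Fin s → ℕ)} (h : E ⊆ E') :
    monomialIdeal f E ≤ monomialIdeal f E' := Ideal.span_mono (Set.image_mono h)

theorem monomialIdeal_filtrationLayer_le (f : Fin s → R) (hcs : c ≤ s)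
    (hD : ∀ a e T, T.card = c → IsLowest a T → (∀ i ∈ T, a i = e i) → e ∈ D → a ∈ D) :
    monomialIdeal f (filtrationLayer D c N r) ≤
      monomialIdeal f (filtrationLayer D c N (r + 1)) ⊔
        monomialIdeal f {a | ∃ T, IsLayerGenerator D c N r a T} := by
  rw [monomialIdeal, Ideal.span_le]
  rintro _ ⟨e, he, rfl⟩
  by_cases he' : e ∈ filtrationLayer D c N (r + 1)
  · exact Ideal.mem_sup_left (Ideal.subset_span ⟨e, he', rfl⟩)
  · obtain ⟨a, T, ha, hle⟩ := exists_isLayerGenerator_le hcs hD he he'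
    refine Ideal.mem_sup_right (Ideal.mem_of_dvd _ ?_ (Ideal.subset_span ⟨a, ⟨T, ha⟩, rfl⟩))
    exact Finset.prod_dvd_prod_of_dvd _ _ fun i _ => pow_dvd_pow _ (hle i)

theorem IsWeaklyGeneric.mem_monomialIdeal_filtrationLayer_succ {f : Fin s → R} {h : ℕ}
    (hf : IsWeaklyGeneric f h) (hc : c ≤ h) (hcs : c ≤ s) (hDup : IsUpperSet D)
    (hD : ∀ a e T, T.card = c → IsLowest a T → (∀ i ∈ T, a i = e i) → e ∈ D → a ∈ D) {x : R}
    (hx : ∀ S : Finset (Fin s), S.card = c → x ∈ Ideal.span (f '' (S : Set (Fin s))) ^ N)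
    (hxr : x ∈ monomialIdeal f (filtrationLayer D c N r)) :
    x ∈ monomialIdeal f (filtrationLayer D c N (r + 1)) := by
  obtain ⟨y, hy, z, hz, rfl⟩ :=
    Submodule.mem_sup.mp (monomialIdeal_filtrationLayer_le f hcs hD hxr)
  obtain ⟨l, hl, rfl⟩ := exists_finsupp_of_mem_monomialIdeal hz
  refine Ideal.add_mem _ hy (Ideal.sum_mem _ fun a ha => ?_)
  obtain ⟨T, hT⟩ := hl ha
  have hyQ : y ∈ Ideal.span ((fun t => f t ^ (a t + 1)) '' (T : Set (Fin s))) := by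
    refine (Ideal.span_le.mpr ?_ : monomialIdeal f _ ≤ _) hy
    rintro _ ⟨u, hu, rfl⟩
    exact prod_pow_mem_span_pow_succ f (hT.exists_lt_of_mem hu)
  have hla : l a ∈ Ideal.span (f '' (T : Set (Fin s))) := by
    refine hf.coeff_mem (hT.card_eq.trans_le hc) l a ?_ ?_
    · intro e he hea
      obtain ⟨T', hT'⟩ := hl he
      exact hT.exists_lt_of_ne hT' hea
    · exact (Ideal.add_mem_iff_right _ hyQ).mp
        (span_image_pow_le_span_pow_succ f hT.sum_lt (hx T hT.card_eq))
  have hle : Ideal.span (f '' (T : Set (Fin s))) * Ideal.span {∏ i, f i ^ a i} ≤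
      monomialIdeal f (filtrationLayer D c N (r + 1)) := by
    rw [Ideal.span_mul_span', Ideal.span_le]
    rintro _ ⟨_, ⟨t, ht, rfl⟩, _, rfl, rfl⟩
    refine Ideal.subset_span ⟨a + Pi.single t 1, hT.add_single_mem hDup ht, ?_⟩
    simp only [prod_pow_add_single]
    exact mul_comm _ _
  exact hle (Ideal.mul_mem_mul hla (Ideal.mem_span_singleton_self _))

theorem filtrationLayer_subset (hcs : c ≤ s) :
    filtrationLayer D c N (s * N + s * s + 1) ⊆
      {e | e ∈ D ∧ ∀ S : Finset (Fin s), S.card = c → N ≤ ∑ i ∈ S, e i} := by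
  rintro e ⟨heD, he | he⟩
  · exact ⟨heD, he⟩
  · refine ⟨heD, fun S hS => ?_⟩
    have h1 := he S hS
    rw [sum_indexWeight] at h1
    have h2 : ∑ i ∈ S, (i : ℕ) ≤ s * s := by
      refine (Finset.sum_le_card_nsmul S _ s fun i _ => i.isLt.le).trans ?_
      rw [hS, smul_eq_mul]
      exact Nat.mul_le_mul_right s hcs
    have h3 : s * N < s * ∑ i ∈ S, e i := by omega
    exact (Nat.lt_of_mul_lt_mul_left h3).le

theorem IsWeaklyGeneric.mem_monomialIdeal_of_mem_pow {f : Fin s → R} {h : ℕ}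
    (hf : IsWeaklyGeneric f h) (hc : c ≤ h) (hcs : c ≤ s) (hDup : IsUpperSet D)
    (hD : ∀ a e T, T.card = c → IsLowest a T → (∀ i ∈ T, a i = e i) → e ∈ D → a ∈ D) {x : R}
    (hx : ∀ S : Finset (Fin s), S.card = c → x ∈ Ideal.span (f '' (S : Set (Fin s))) ^ N)
    (hxD : x ∈ monomialIdeal f D) :
    x ∈ monomialIdeal f
      {e | e ∈ D ∧ ∀ S : Finset (Fin s), S.card = c → N ≤ ∑ i ∈ S, e i} := by
  refine monomialIdeal_mono (filtrationLayer_subset hcs) ?_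
  generalize s * N + s * s + 1 = r
  induction r with
  | zero =>
    have hsub : D ⊆ filtrationLayer D c N 0 := fun e he => ⟨he, Or.inr fun _ _ => Nat.zero_le _⟩
    exact monomialIdeal_mono hsub hxD
  | succ r ih => exact hf.mem_monomialIdeal_filtrationLayer_succ hc hcs hDup hD hx ih

/-- Exponent vectors of the monomials in the intersection of the powers `⟨zᵢ : i ∈ S⟩ ^ N |S|`
over all `S` with `p ≤ |S| < q`. -/
def symmetricExponents (s p q : ℕ) (N : ℕ → ℕ) : Set (Fin s → ℕ) :=
  {e | ∀ S : Finset (Fin s), p ≤ S.card → S.card < q → N S.card ≤ ∑ i ∈ S, e i}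

theorem IsWeaklyGeneric.mem_monomialIdeal_symmetricExponents {f : Fin s → R} {h : ℕ}
    (hf : IsWeaklyGeneric f h) (N : ℕ → ℕ) {p q : ℕ} (hq : q ≤ h + 1) (hqs : q ≤ s + 1) {x : R}
    (hx : ∀ S : Finset (Fin s), p ≤ S.card → S.card < q →
      x ∈ Ideal.span (f '' (S : Set (Fin s))) ^ N S.card) :
    x ∈ monomialIdeal f (symmetricExponents s p q N) := by
  induction q with
  | zero =>
    have h1 : (1 : R) ∈ monomialIdeal f (symmetricExponents s p 0 N) :=
      Ideal.subset_span ⟨0, fun S _ hS => absurd hS (Nat.not_lt_zero _), by simp⟩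
    rw [(Ideal.eq_top_iff_one _).mpr h1]
    trivial
  | succ q ih =>
    have hxq := ih (by omega) (by omega) fun S hS hSq => hx S hS (hSq.trans (Nat.lt_succ_self q))
    by_cases hpq : p ≤ q
    · refine monomialIdeal_mono ?_ (hf.mem_monomialIdeal_of_mem_pow (c := q) (N := N q) (by omega)
        (by omega) ?_ ?_ ?_ hxq)
      · rintro e ⟨he, heq⟩ S hpS hSq
        rcases (Nat.lt_succ_iff_lt_or_eq).mp hSq with hlt | heq'
        · exact he S hpS hlt
        · rw [heq']; exact heq S heq'
      · intro e e' hle he S hpS hSq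
        exact (he S hpS hSq).trans (Finset.sum_le_sum fun i _ => hle i)
      · intro a e T hTc hT hae he S hpS hSq
        obtain ⟨S', hS'T, hS'c, hS'⟩ := hT.exists_subset (S := S) (by omega)
        refine le_trans ?_ hS'
        rw [Finset.sum_congr rfl fun i hi => hae i (hS'T hi), ← hS'c]
        exact he S' (by omega) (by omega)
      · intro S hS
        have := hx S (by omega) (by omega)
        rwa [hS] at this
    · refine monomialIdeal_mono (fun e he S hpS hSq => ?_) hxq
      omega

end Intersection

/-- Under the homomorphism `φ : K[z₁,…,z_s] → R`, `zᵢ ↦ fᵢ`, the ideal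
`K_j = ⋂_{c=c₀}^{h-j} I_{c,F}^{(m·μ̂_c)}` is the extension `φ(K_j(z))R` of the monomial
ideal `K_j(z) = ⋂_{c=c₀}^{h-j} ⋂_{|S|=c} ⟨zᵢ : i ∈ S⟩^{m·μ̂_c}`. -/
theorem filtration_extension {K : Type*} [Field K] [Infinite K]
    (n s a b d : ℕ) (hs : 0 < s) (ha : 0 < a) (hb0 : 0 < b) (hd : 0 < d)
    (ha1 : (b - 1) * s + 1 < a) (ha2 : a ≤ b * s)
    (h c₀ μ₀ : ℕ) (hh : h = b * s - a + 1) (hc₀ : c₀ = s - (a - 1) / b)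
    (hμ₀ : μ₀ = a - b * (s - c₀)) (hn : h ≤ n)
    (f : Fin s → MvPolynomial (Fin (n + 1)) K)
    (hinj : Function.Injective f) (hne : ∀ i, f i ≠ 0)
    (hhom : ∀ i, (f i).IsHomogeneous d)
    (hgen : ∀ l : List (Fin s), l.Nodup → l.length ≤ h + 1 →
      RingTheory.Sequence.IsRegular (MvPolynomial (Fin (n + 1)) K) (l.map f))
    (m : ℕ) (hm : 0 < m) (j : ℕ) (hj : j ≤ h - c₀)
    (Kjz : Ideal (MvPolynomial (Fin s) K))
    (hKjz : Kjz = ⨅ (c : ℕ) (_ : c₀ ≤ c) (_ : c ≤ h - j)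
        (S : Finset (Fin s)) (_ : S.card = c),
      (Ideal.span (X '' (S : Set (Fin s))) : Ideal (MvPolynomial (Fin s) K)) ^
        (m * (μ₀ + b * (c - c₀))))
    (Kj : Ideal (MvPolynomial (Fin (n + 1)) K))
    (hKj : Kj = ⨅ (c : ℕ) (_ : c₀ ≤ c) (_ : c ≤ h - j),
      symbolicPower (starConfigIdeal f c) (m * (μ₀ + b * (c - c₀)))) :
    Kj = Ideal.map
      (MvPolynomial.aeval f : MvPolynomial (Fin s) K →ₐ[K] MvPolynomial (Fin (n + 1)) K)
      Kjz := by
  subst hKj hKjz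
  have hs_le : h ≤ s := by
    obtain ⟨b', rfl⟩ : ∃ b', b = b' + 1 := ⟨b - 1, by omega⟩
    rw [Nat.add_sub_cancel] at ha1
    rw [add_mul, one_mul] at hh
    omega
  have hf := isWeaklyGeneric_of_isRegular hgen
  apply le_antisymm
  · intro x hx
    simp only [Submodule.mem_iInf] at hx
    have hmem := hf.mem_monomialIdeal_symmetricExponents (fun c => m * (μ₀ + b * (c - c₀)))
      (p := c₀) (q := h - j + 1) (by omega) (by omega) (x := x) fun S hpS hSq =>
        (mem_symbolicPower_starConfigIdeal_iff hf (by omega)).mp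
          (hx S.card hpS (by omega)) S rfl
    refine (Ideal.span_le.mpr ?_ : monomialIdeal f _ ≤ _) hmem
    rintro _ ⟨e, he, rfl⟩
    have hmon : ∏ i, f i ^ e i = (MvPolynomial.aeval f :
        MvPolynomial (Fin s) K →ₐ[K] MvPolynomial (Fin (n + 1)) K) (∏ i, X i ^ e i) := by
      simp
    simp only [hmon]
    refine Ideal.mem_map_of_mem _ ?_
    simp only [Submodule.mem_iInf]
    rintro c hc hcj S rfl
    exact prod_pow_mem_span_image_pow X (he S hc (by omega))
  · refine le_iInf fun c => le_iInf fun hc => le_iInf fun hcj => fun x hx => ?_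
    refine (mem_symbolicPower_starConfigIdeal_iff hf (by omega)).mpr fun S hS => ?_
    have hle := Ideal.map_mono (f := (MvPolynomial.aeval f :
        MvPolynomial (Fin s) K →ₐ[K] MvPolynomial (Fin (n + 1)) K))
      ((iInf_le _ c).trans <| (iInf_le _ hc).trans <| (iInf_le _ hcj).trans <|
        (iInf_le _ S).trans <| iInf_le _ hS) hx
    rw [Ideal.map_pow, Ideal.map_span, Set.image_image] at hle
    simpa using hle
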